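/- Define on ℝ³ \ {0} the vector fields W_i with components W_i^j(x) := −(x_i x_j + 3|x|² δ_{ij})/|x|³, and let L be the operator (L W)^j = −ΔW^j − ∂_j(∂_k W^k). Then E_i := L W_i is supported in {|x| ≤ 1} after modification by a radius function, and its total integrals satisfy ∫_{ℝ³} E_i^i dx = −16π for each i (no summation) and ∫_{ℝ³} E_i^j dx = 0 for i ≠ j. -/

import Mathlib

open MeasureTheory Filter
open scoped BigOperators Topology RealInnerProductSpace

noncomputable section

abbrev E3 : Type := EuclideanSpace ℝ (Fin 3)

/-- Partial derivative in the `i`-th coordinate direction. -/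
noncomputable def pd (i : Fin 3) (f : E3 → ℝ) (x : E3) : ℝ :=
  fderiv ℝ f x (EuclideanSpace.single i 1)

/-- Euclidean Laplacian on `ℝ³`. -/
noncomputable def lap (f : E3 → ℝ) (x : E3) : ℝ :=
  ∑ i : Fin 3, pd i (pd i f) x

/-- `W_i^j(x) = −(x_i x_j + 3 r(x)² δ_{ij})/r(x)³`, with a radius function `r`. -/
noncomputable def Wfield (r : E3 → ℝ) (i j : Fin 3) (x : E3) : ℝ :=
  -(x i * x j + 3 * (r x) ^ 2 * (if i = j then (1 : ℝ) else 0)) / (r x) ^ 3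

/-- `E_i^j = (L W_i)^j = −ΔW_i^j − ∂_j(∂_k W_i^k)`. -/
noncomputable def Efield (r : E3 → ℝ) (i j : Fin 3) (x : E3) : ℝ :=
  -(lap (Wfield r i j) x) - pd j (fun y : E3 => ∑ k : Fin 3, pd k (Wfield r i k) y) x

/-- Kronecker delta. -/
def dl (i k : Fin 3) : ℝ := if i = k then 1 else 0

lemma hd_coord (x : E3) (k i : Fin 3) :
    HasDerivAt (fun t : ℝ => (x + t • (EuclideanSpace.single k (1:ℝ) : E3)) i) (dl i k) 0 := by
  have h : (fun t : ℝ => (x + t • (EuclideanSpace.single k (1:ℝ) : E3)) i)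
      = fun t : ℝ => x i + t * dl i k := by
    funext t
    simp [dl]
  rw [h]
  simpa using ((hasDerivAt_id (0:ℝ)).mul_const (dl i k)).const_add (x i)

lemma hd_line (x : E3) (k : Fin 3) :
    HasDerivAt (fun t : ℝ => x + t • (EuclideanSpace.single k (1:ℝ) : E3))
      (EuclideanSpace.single k (1:ℝ) : E3) 0 := by
  simpa using ((hasDerivAt_id (0:ℝ)).smul_const (EuclideanSpace.single k (1:ℝ) : E3)).const_add x

lemma hd_nsq (x : E3) (k : Fin 3) :
    HasDerivAt (fun t : ℝ => ‖x + t • (EuclideanSpace.single k (1:ℝ) : E3)‖ ^ 2) (2 * x k) 0 := by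
  have := (hd_line x k).norm_sq
  simpa [EuclideanSpace.inner_single_right] using this

lemma hd_q (x : E3) (hx : x ≠ 0) (k : Fin 3) :
    HasDerivAt (fun t : ℝ => ‖x + t • (EuclideanSpace.single k (1:ℝ) : E3)‖⁻¹)
      (-(x k) * (‖x‖⁻¹) ^ 3) 0 := by
  have hn : ‖x‖ ≠ 0 := norm_ne_zero_iff.2 hx
  have h1 := (hd_nsq x k).sqrt (by simpa using hn)
  have h2 := h1.fun_inv (by simpa using hn)
  simp only [Real.sqrt_sq (norm_nonneg _)] at h2
  refine h2.congr_deriv ?_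
  simp only [zero_smul, add_zero]
  field_simp

lemma pd_of_line {f : E3 → ℝ} {x : E3} {k : Fin 3} {f' : ℝ} (hf : DifferentiableAt ℝ f x)
    (h : HasDerivAt (fun t : ℝ => f (x + t • (EuclideanSpace.single k (1:ℝ) : E3))) f' 0) :
    pd k f x = f' := by
  unfold pd
  rw [← hf.lineDeriv_eq_fderiv]
  exact HasLineDerivAt.lineDeriv h

lemma pd_congr {f g : E3 → ℝ} {x : E3} {k : Fin 3} (h : f =ᶠ[𝓝 x] g) : pd k f x = pd k g x := by
  unfold pd
  rw [h.fderiv_eq]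

lemma pd_smooth {f : E3 → ℝ} (hf : ContDiff ℝ (⊤ : ℕ∞) f) (k : Fin 3) :
    ContDiff ℝ (⊤ : ℕ∞) (pd k f) := by
  unfold pd
  exact (hf.fderiv_right (m := (⊤ : ℕ∞)) (by simp)).clm_apply contDiff_const

lemma W_smooth {r : E3 → ℝ} (hsm : ContDiff ℝ (⊤ : ℕ∞) r)
    (hlb : ∀ x : E3, Real.exp (-(1 / 2)) ≤ r x) (i j : Fin 3) :
    ContDiff ℝ (⊤ : ℕ∞) (Wfield r i j) := by
  unfold Wfield
  have hc : ∀ i : Fin 3, ContDiff ℝ (⊤ : ℕ∞) (fun x : E3 => x i) := fun i => by fun_prop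
  refine ContDiff.div ?_ (hsm.pow 3) ?_
  · exact (((hc i).mul (hc j)).add ((contDiff_const.mul (hsm.pow 2)).mul contDiff_const)).neg
  · intro x
    exact pow_ne_zero _ ((Real.exp_pos _).trans_le (hlb x)).ne'

lemma W_explicit {r : E3 → ℝ} (hout : ∀ x : E3, 1 ≤ ‖x‖ → r x = ‖x‖) (i j : Fin 3)
    (x : E3) (hx : 1 < ‖x‖) :
    Wfield r i j x = -(x i * x j * (‖x‖⁻¹) ^ 3 + 3 * dl i j * ‖x‖⁻¹) := by
  unfold Wfield dl
  rw [hout x hx.le]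
  have : ‖x‖ ≠ 0 := by positivity
  field_simp

lemma ev_out (x : E3) (hx : 1 < ‖x‖) : ∀ᶠ y in 𝓝 x, 1 < ‖y‖ :=
  continuous_norm.continuousAt.eventually (lt_mem_nhds hx)

lemma ne_of_out {x : E3} (hx : 1 < ‖x‖) : x ≠ 0 := by
  rintro rfl
  simp at hx
  linarith

/-- First derivative away from the unit ball. -/
lemma pdW {r : E3 → ℝ} (hsm : ContDiff ℝ (⊤ : ℕ∞) r)
    (hlb : ∀ x : E3, Real.exp (-(1 / 2)) ≤ r x)
    (hout : ∀ x : E3, 1 ≤ ‖x‖ → r x = ‖x‖) (i j k : Fin 3)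
    (x : E3) (hx : 1 < ‖x‖) :
    pd k (Wfield r i j) x = -(dl i k * x j * (‖x‖⁻¹) ^ 3 + x i * dl j k * (‖x‖⁻¹) ^ 3
      - 3 * x i * x j * x k * (‖x‖⁻¹) ^ 5 - 3 * dl i j * x k * (‖x‖⁻¹) ^ 3) := by
  have hW := W_smooth hsm hlb i j
  have hev : Wfield r i j =ᶠ[𝓝 x]
      fun x => -(x i * x j * (‖x‖⁻¹) ^ 3 + 3 * dl i j * ‖x‖⁻¹) := by
    filter_upwards [ev_out x hx] with y hy using W_explicit hout i j y hy
  rw [pd_congr hev]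
  refine pd_of_line (hev.differentiableAt_iff.1 (hW.differentiable (by simp) x)) ?_
  have hq := hd_q x (ne_of_out hx) k
  have := ((((hd_coord x k i).fun_mul (hd_coord x k j)).fun_mul (hq.fun_pow 3)).fun_add
    (hq.const_mul (3 * dl i j))).fun_neg
  refine this.congr_deriv ?_
  simp only [zero_smul, add_zero]
  push_cast
  ring

/-- Second derivative away from the unit ball. -/
lemma pdpdW {r : E3 → ℝ} (hsm : ContDiff ℝ (⊤ : ℕ∞) r)
    (hlb : ∀ x : E3, Real.exp (-(1 / 2)) ≤ r x)
    (hout : ∀ x : E3, 1 ≤ ‖x‖ → r x = ‖x‖) (i j k l : Fin 3)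
    (x : E3) (hx : 1 < ‖x‖) :
    pd l (pd k (Wfield r i j)) x = -(dl i k * dl j l * (‖x‖⁻¹) ^ 3
      - 3 * dl i k * x j * x l * (‖x‖⁻¹) ^ 5 + dl i l * dl j k * (‖x‖⁻¹) ^ 3
      - 3 * x i * dl j k * x l * (‖x‖⁻¹) ^ 5
      - 3 * dl i l * x j * x k * (‖x‖⁻¹) ^ 5 - 3 * x i * dl j l * x k * (‖x‖⁻¹) ^ 5
      - 3 * x i * x j * dl k l * (‖x‖⁻¹) ^ 5 + 15 * x i * x j * x k * x l * (‖x‖⁻¹) ^ 7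
      - 3 * dl i j * dl k l * (‖x‖⁻¹) ^ 3 + 9 * dl i j * x k * x l * (‖x‖⁻¹) ^ 5) := by
  have hW := pd_smooth (W_smooth hsm hlb i j) k
  have hev : pd k (Wfield r i j) =ᶠ[𝓝 x]
      fun x => -(dl i k * x j * (‖x‖⁻¹) ^ 3 + x i * dl j k * (‖x‖⁻¹) ^ 3
      - 3 * x i * x j * x k * (‖x‖⁻¹) ^ 5 - 3 * dl i j * x k * (‖x‖⁻¹) ^ 3) := by
    filter_upwards [ev_out x hx] with y hy using pdW hsm hlb hout i j k y hy
  rw [pd_congr hev]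
  refine pd_of_line (hev.differentiableAt_iff.1 (hW.differentiable (by simp) x)) ?_
  have hq := hd_q x (ne_of_out hx) l
  have hi := hd_coord x l i
  have hj := hd_coord x l j
  have hk := hd_coord x l k
  have := ((((((hj.const_mul (dl i k)).fun_mul (hq.fun_pow 3)).fun_add
    ((hi.mul_const (dl j k)).fun_mul (hq.fun_pow 3))).fun_sub
    ((((hi.const_mul 3).fun_mul hj).fun_mul hk).fun_mul (hq.fun_pow 5))).fun_sub
    ((hk.const_mul (3 * dl i j)).fun_mul (hq.fun_pow 3)))).fun_neg
  refine this.congr_deriv ?_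
  simp only [zero_smul, add_zero]
  push_cast
  ring

lemma q_rel (x : E3) (hx : 1 < ‖x‖) : (‖x‖⁻¹) ^ 2 * (x 0 ^ 2 + x 1 ^ 2 + x 2 ^ 2) = 1 := by
  have h : ‖x‖ ^ 2 = x 0 ^ 2 + x 1 ^ 2 + x 2 ^ 2 := by
    rw [EuclideanSpace.norm_sq_eq]
    simp [Fin.sum_univ_three]
  rw [← h]
  have : ‖x‖ ≠ 0 := by positivity
  field_simp

lemma sum_dl (k : Fin 3) (f : Fin 3 → ℝ) : dl k 0 * f 0 + dl k 1 * f 1 + dl k 2 * f 2 = f k := by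
  fin_cases k <;> simp [dl]

/-- The divergence of `W_i`. -/
def Dv (r : E3 → ℝ) (i : Fin 3) (y : E3) : ℝ := ∑ k : Fin 3, pd k (Wfield r i k) y

lemma Dv_smooth {r : E3 → ℝ} (hsm : ContDiff ℝ (⊤ : ℕ∞) r)
    (hlb : ∀ x : E3, Real.exp (-(1 / 2)) ≤ r x) (i : Fin 3) :
    ContDiff ℝ (⊤ : ℕ∞) (Dv r i) := by
  unfold Dv
  exact ContDiff.sum fun k _ => pd_smooth (W_smooth hsm hlb i k) k

lemma Dv_explicit {r : E3 → ℝ} (hsm : ContDiff ℝ (⊤ : ℕ∞) r)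
    (hlb : ∀ x : E3, Real.exp (-(1 / 2)) ≤ r x)
    (hout : ∀ x : E3, 1 ≤ ‖x‖ → r x = ‖x‖) (i : Fin 3)
    (x : E3) (hx : 1 < ‖x‖) : Dv r i x = 2 * x i * (‖x‖⁻¹) ^ 3 := by
  unfold Dv
  simp only [pdW hsm hlb hout i _ _ x hx, Fin.sum_univ_three]
  have h := q_rel x hx
  generalize ‖x‖⁻¹ = q at *
  fin_cases i <;> simp [dl]
  · linear_combination 3 * x 0 * q ^ 3 * h
  · linear_combination 3 * x 1 * q ^ 3 * h
  · linear_combination 3 * x 2 * q ^ 3 * h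

lemma pdDv {r : E3 → ℝ} (hsm : ContDiff ℝ (⊤ : ℕ∞) r)
    (hlb : ∀ x : E3, Real.exp (-(1 / 2)) ≤ r x)
    (hout : ∀ x : E3, 1 ≤ ‖x‖ → r x = ‖x‖) (i j : Fin 3)
    (x : E3) (hx : 1 < ‖x‖) :
    pd j (Dv r i) x = 2 * dl i j * (‖x‖⁻¹) ^ 3 - 6 * x i * x j * (‖x‖⁻¹) ^ 5 := by
  have hev : Dv r i =ᶠ[𝓝 x] fun x => 2 * x i * (‖x‖⁻¹) ^ 3 := by
    filter_upwards [ev_out x hx] with y hy using Dv_explicit hsm hlb hout i y hy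
  rw [pd_congr hev]
  refine pd_of_line (hev.differentiableAt_iff.1
    ((Dv_smooth hsm hlb i).differentiable (by simp) x)) ?_
  have hq := hd_q x (ne_of_out hx) j
  have := ((hd_coord x j i).const_mul 2).fun_mul (hq.fun_pow 3)
  refine this.congr_deriv ?_
  simp only [zero_smul, add_zero]
  push_cast
  ring

lemma E_zero {r : E3 → ℝ} (hsm : ContDiff ℝ (⊤ : ℕ∞) r)
    (hlb : ∀ x : E3, Real.exp (-(1 / 2)) ≤ r x)
    (hout : ∀ x : E3, 1 ≤ ‖x‖ → r x = ‖x‖) (i j : Fin 3)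
    (x : E3) (hx : 1 < ‖x‖) : Efield r i j x = 0 := by
  have h1 := pdDv hsm hlb hout i j x hx
  unfold Dv at h1
  unfold Efield lap
  rw [h1]
  simp only [pdpdW hsm hlb hout i j _ _ x hx, Fin.sum_univ_three]
  have h := q_rel x hx
  generalize ‖x‖⁻¹ = q at *
  have hs : ∀ k : Fin 3, dl k k = 1 := fun k => by simp [dl]
  have e1 := sum_dl i (fun k => dl j k)
  have e2 := sum_dl i (fun k => x k)
  have e3 := sum_dl j (fun k => x k)
  have e4 : dl j i = dl i j := by simp [dl, eq_comm]
  simp only [hs, e4] at *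
  linear_combination (2 * q ^ 3) * e1 - (6 * x j * q ^ 5) * e2 - (6 * x i * q ^ 5) * e3
    + (15 * x i * x j * q ^ 5 + 9 * dl i j * q ^ 3) * h

/-- Cutoff profile. -/
def hcut (s : ℝ) : ℝ := Real.smoothTransition (5 - s)

lemma hcut_smooth : ContDiff ℝ (⊤ : ℕ∞) hcut :=
  Real.smoothTransition.contDiff.comp (contDiff_const.sub contDiff_id)

lemma hcut_one {s : ℝ} (hs : s ≤ 4) : hcut s = 1 :=
  Real.smoothTransition.one_of_one_le (by linarith)

lemma hcut_zero {s : ℝ} (hs : 5 ≤ s) : hcut s = 0 :=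
  Real.smoothTransition.zero_of_nonpos (by linarith)

lemma dhcut_zero {s : ℝ} (hs : s < 4) : deriv hcut s = 0 := by
  have : hcut =ᶠ[𝓝 s] fun _ => 1 := by
    filter_upwards [gt_mem_nhds hs] with y hy using hcut_one hy.le
  rw [this.deriv_eq]
  simp

lemma dhcut_zero' {s : ℝ} (hs : 5 < s) : deriv hcut s = 0 := by
  have : hcut =ᶠ[𝓝 s] fun _ => 0 := by
    filter_upwards [lt_mem_nhds hs] with y hy using hcut_zero hy.le
  rw [this.deriv_eq]
  simp

lemma dhcut_cont : Continuous (deriv hcut) := hcut_smooth.continuous_deriv (by simp)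

lemma hcut_hasDeriv (s : ℝ) : HasDerivAt hcut (deriv hcut s) s :=
  (hcut_smooth.differentiable (by simp) s).hasDerivAt

/-- Cutoff function on space. -/
def chi (x : E3) : ℝ := hcut (‖x‖ ^ 2)

lemma chi_smooth : ContDiff ℝ (⊤ : ℕ∞) chi := hcut_smooth.comp (contDiff_norm_sq ℝ)

lemma pd_chi (x : E3) (k : Fin 3) : pd k chi x = deriv hcut (‖x‖ ^ 2) * (2 * x k) := by
  refine pd_of_line (chi_smooth.differentiable (by simp) x) ?_
  unfold chi
  have h := hcut_hasDeriv (‖x + (0:ℝ) • (EuclideanSpace.single k (1:ℝ) : E3)‖ ^ 2)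
  have := h.comp (0:ℝ) (hd_nsq x k)
  simpa [Function.comp_def] using this

lemma cs_of_zero {f : E3 → ℝ} (h : ∀ x : E3, 3 < ‖x‖ → f x = 0) : HasCompactSupport f := by
  refine HasCompactSupport.intro (isCompact_closedBall (0 : E3) 3) ?_
  intro x hx
  exact h x (by simpa using hx)

lemma chi_zero (x : E3) (hx : 3 < ‖x‖) : chi x = 0 := hcut_zero (by nlinarith)

lemma pdchi_zero (k : Fin 3) (x : E3) (hx : 3 < ‖x‖) : pd k chi x = 0 := by
  rw [pd_chi, dhcut_zero' (by nlinarith), zero_mul]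

lemma int_chi {f : E3 → ℝ} (hf : Continuous f) : Integrable (fun x => chi x * f x) :=
  (chi_smooth.continuous.mul hf).integrable_of_hasCompactSupport
    (cs_of_zero fun x hx => by simp [chi_zero x hx])

lemma int_pdchi (k : Fin 3) {f : E3 → ℝ} (hf : Continuous f) :
    Integrable (fun x => pd k chi x * f x) :=
  ((pd_smooth chi_smooth k).continuous.mul hf).integrable_of_hasCompactSupport
    (cs_of_zero fun x hx => by simp [pdchi_zero k x hx])

lemma ibp (k : Fin 3) {f : E3 → ℝ} (hf : ContDiff ℝ (⊤ : ℕ∞) f) :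
    ∫ x, chi x * pd k f x = - ∫ x, pd k chi x * f x :=
  integral_mul_fderiv_eq_neg_fderiv_mul_of_integrable
    (int_pdchi k hf.continuous) (int_chi (pd_smooth hf k).continuous) (int_chi hf.continuous)
    (fun x _ => chi_smooth.differentiable (by simp) x)
    (fun x _ => hf.differentiable (by simp) x)

/-- The reduced integrand. -/
def red (i j : Fin 3) (x : E3) : ℝ :=
  6 * deriv hcut (‖x‖ ^ 2) * (x i * x j * (‖x‖⁻¹) ^ 3 + dl i j * ‖x‖⁻¹)

lemma int_E_red {r : E3 → ℝ} (hsm : ContDiff ℝ (⊤ : ℕ∞) r)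
    (hlb : ∀ x : E3, Real.exp (-(1 / 2)) ≤ r x)
    (hout : ∀ x : E3, 1 ≤ ‖x‖ → r x = ‖x‖) (i j : Fin 3) :
    ∫ x, Efield r i j x = ∫ x, red i j x := by
  have hW := W_smooth hsm hlb i j
  have hD := Dv_smooth hsm hlb i
  have hpp : ∀ k, Continuous (pd k (pd k (Wfield r i j))) :=
    fun k => (pd_smooth (pd_smooth hW k) k).continuous
  have h1 : ∀ x, Efield r i j x = -(∑ k : Fin 3, chi x * pd k (pd k (Wfield r i j)) x)
      - chi x * pd j (Dv r i) x := by
    intro x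
    have : Efield r i j x = chi x * Efield r i j x := by
      by_cases hx : 1 < ‖x‖
      · rw [E_zero hsm hlb hout i j x hx, mul_zero]
      · rw [chi, hcut_one (by nlinarith [norm_nonneg x]), one_mul]
    rw [this]
    unfold Efield lap Dv
    rw [← Finset.mul_sum]
    ring
  have h2 : ∀ x, red i j x = (∑ k : Fin 3, pd k chi x * pd k (Wfield r i j) x)
      + pd j chi x * Dv r i x := by
    intro x
    unfold red
    simp only [pd_chi]
    by_cases hx : 1 < ‖x‖
    · rw [Dv_explicit hsm hlb hout i x hx]
      simp only [pdW hsm hlb hout i j _ x hx, Fin.sum_univ_three]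
      have h := q_rel x hx
      generalize ‖x‖⁻¹ = q at *
      have e2 := sum_dl i (fun k => x k)
      have e3 := sum_dl j (fun k => x k)
      generalize deriv hcut (‖x‖ ^ 2) = H
      linear_combination (2 * H * x j * q ^ 3) * e2 + (2 * H * x i * q ^ 3) * e3
        - (6 * H * x i * x j * q ^ 3 + 6 * H * dl i j * q) * h
    · rw [dhcut_zero (by nlinarith [norm_nonneg x])]
      simp
  simp only [h1, h2]
  have hneg : Integrable (fun x => -(∑ k : Fin 3, chi x * pd k (pd k (Wfield r i j)) x)) :=
    (integrable_finsetSum _ fun k _ => int_chi (hpp k)).neg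
  rw [integral_sub hneg (int_chi (pd_smooth hD j).continuous), integral_neg,
    integral_finsetSum _ (fun k _ => int_chi (hpp k)),
    integral_add (integrable_finsetSum _ fun k _ =>
      int_pdchi k (pd_smooth hW k).continuous) (int_pdchi j hD.continuous),
    integral_finsetSum _ (fun k _ => int_pdchi k (pd_smooth hW k).continuous), ibp j hD]
  simp only [ibp _ (pd_smooth hW _)]
  simp

lemma int_red_off (i j : Fin 3) (h : j ≠ i) : ∫ x, red i j x = 0 := by
  let e : E3 ≃ₗᵢ[ℝ] E3 := LinearIsometryEquiv.piLpCongrRight 2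
    (fun k : Fin 3 => if k = i then LinearIsometryEquiv.neg ℝ else LinearIsometryEquiv.refl ℝ ℝ)
  have hi : ∀ x, e x i = - x i := fun x => by simp [e]
  have hj : ∀ x, e x j = x j := fun x => by simp [e, h]
  have h1 : ∫ x, red i j (e x) = ∫ x, red i j x :=
    e.measurePreserving.integral_comp e.toHomeomorph.measurableEmbedding _
  have h2 : ∀ x, red i j (e x) = - red i j x := fun x => by
    simp only [red, hi, hj, e.norm_map, dl, if_neg h.symm]
    ring
  simp only [h2, integral_neg] at h1
  linarith

lemma int_red_diag (i j : Fin 3) : ∫ x, red i i x = ∫ x, red j j x := by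
  let e : E3 ≃ₗᵢ[ℝ] E3 := LinearIsometryEquiv.piLpCongrLeft 2 ℝ ℝ (Equiv.swap i j)
  have hi : ∀ x, e x i = x j := fun x => by
    simp [e, LinearIsometryEquiv.piLpCongrLeft_apply]
  have h1 : ∫ x, red i i (e x) = ∫ x, red i i x :=
    e.measurePreserving.integral_comp e.toHomeomorph.measurableEmbedding _
  rw [← h1]
  congr 1
  funext x
  simp only [red, hi, e.norm_map, dl, if_true]

lemma rad_int : ∫ x : E3, deriv hcut (‖x‖ ^ 2) * ‖x‖⁻¹ = - 2 * Real.pi := by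
  have h := integral_fun_norm_addHaar (volume : Measure E3)
    (fun s : ℝ => deriv hcut (s ^ 2) * s⁻¹)
  rw [h]
  have h1 : ∫ y in Set.Ioi (0:ℝ), y * deriv hcut (y ^ 2) = 0 - hcut (0 ^ 2) / 2 := by
    refine integral_Ioi_of_hasDerivAt_of_tendsto' (f := fun y => hcut (y ^ 2) / 2) ?_ ?_ ?_
    · intro x _
      have := ((hcut_hasDeriv (x ^ 2)).comp x (hasDerivAt_pow 2 x)).div_const 2
      refine this.congr_deriv ?_
      push_cast
      ring
    · refine Integrable.integrableOn ?_
      refine Continuous.integrable_of_hasCompactSupport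
        (continuous_id.mul (dhcut_cont.comp (continuous_pow 2))) ?_
      refine HasCompactSupport.intro (isCompact_closedBall (0 : ℝ) 3) ?_
      intro x hx
      have hx : 3 < |x| := by simpa using hx
      rw [dhcut_zero' (by rw [← sq_abs]; nlinarith), mul_zero]
    · refine tendsto_const_nhds.congr' ?_
      filter_upwards [eventually_ge_atTop 3] with y hy
      rw [hcut_zero (by nlinarith)]
      simp
  have h2 : ∫ y in Set.Ioi (0:ℝ), y ^ (Module.finrank ℝ E3 - 1) • (deriv hcut (y ^ 2) * y⁻¹)
      = ∫ y in Set.Ioi (0:ℝ), y * deriv hcut (y ^ 2) := by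
    refine setIntegral_congr_fun measurableSet_Ioi ?_
    intro y hy
    have hy : y ≠ 0 := ne_of_gt hy
    simp only [finrank_euclideanSpace, Fintype.card_fin, smul_eq_mul]
    norm_num
    field_simp
  rw [h2, h1, hcut_one (by norm_num)]
  have : (0:ℝ) ≤ Real.pi * 4 / 3 := by positivity
  simp [Measure.real, EuclideanSpace.volume_ball_fin_three, ENNReal.toReal_ofReal this]
  ring

lemma red_int (i : Fin 3) : Integrable (red i i) := by
  have hq : Continuous (fun x : E3 => (max ‖x‖ 1)⁻¹) :=
    (continuous_norm.max continuous_const).inv₀ fun x => by positivity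
  have : red i i = fun x => 6 * deriv hcut (‖x‖ ^ 2) *
      (x i * x i * ((max ‖x‖ 1)⁻¹) ^ 3 + dl i i * (max ‖x‖ 1)⁻¹) := by
    funext x
    unfold red
    by_cases hx : 1 < ‖x‖
    · rw [max_eq_left hx.le]
    · rw [dhcut_zero (by nlinarith [norm_nonneg x])]
      simp
  rw [this]
  refine Continuous.integrable_of_hasCompactSupport ?_ ?_
  · have h0 := dhcut_cont.comp (continuous_norm (E := E3) |>.pow 2)
    have hx : Continuous (fun x : E3 => x i) := by fun_prop
    exact (continuous_const.mul h0).mul (((hx.mul hx).mul (hq.pow 3)).add (continuous_const.mul hq))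
  · refine cs_of_zero fun x hx => ?_
    rw [dhcut_zero' (by nlinarith)]
    simp

lemma int_red_eq (i : Fin 3) : ∫ x, red i i x = -16 * Real.pi := by
  have h : ∑ k : Fin 3, ∫ x, red k k x = 24 * (-2 * Real.pi) := by
    rw [← integral_finsetSum _ (fun k _ => red_int k), ← rad_int, ← integral_const_mul]
    congr 1
    funext x
    by_cases hx : 1 < ‖x‖
    · have h := q_rel x hx
      simp only [red, Fin.sum_univ_three, dl, if_true]
      generalize ‖x‖⁻¹ = q at *
      linear_combination 6 * deriv hcut (‖x‖ ^ 2) * q * h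
    · simp only [red]
      rw [dhcut_zero (by nlinarith [norm_nonneg x])]
      simp
  simp only [int_red_diag _ i] at h
  simp at h
  linarith

/-- for any smooth radius function `r ≥ e^{-1/2}` with `r(x) = |x|`
for `|x| ≥ 1`, the fields `E_i = L W_i` are supported in the closed unit ball, and
`∫ E_i^i = −16π` (no summation) while `∫ E_i^j = 0` for `i ≠ j`. -/
theorem stmt18 (r : E3 → ℝ) (hsm : ContDiff ℝ (⊤ : ℕ∞) r)
    (hlb : ∀ x : E3, Real.exp (-(1 / 2)) ≤ r x)
    (hout : ∀ x : E3, 1 ≤ ‖x‖ → r x = ‖x‖) (i : Fin 3) :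
    (∀ (j : Fin 3) (x : E3), 1 < ‖x‖ → Efield r i j x = 0)
    ∧ (∫ x : E3, Efield r i i x) = -16 * Real.pi
    ∧ ∀ j : Fin 3, j ≠ i → (∫ x : E3, Efield r i j x) = 0 := by
  refine ⟨fun j x hx => E_zero hsm hlb hout i j x hx, ?_, fun j hj => ?_⟩
  · rw [int_E_red hsm hlb hout, int_red_eq]
  · rw [int_E_red hsm hlb hout, int_red_off i j hj]
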